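/- Let λ ∈ ℝ and let r ≥ 0 be an integer. For all integers k, p with k ≥ p ≥ 0, the degenerate r-Stirling numbers of the second kind satisfy {k+r \brace p+r}_{r,λ} = Σ_{m=p}^{k} [ C(k,m) (−1)^{k−m} ⟨1⟩_{k−m,λ} ( {(m+1)+r \brace (p+1)+r}_{r,λ} − r · {m+r \brace (p+1)+r}_{r,λ} ) + λ k · C(k−1,m) (−1)^{k−m−1} ⟨1⟩_{k−m−1,λ} · {(m+1)+r \brace (p+1)+r}_{r,λ} ], where C(·,·) is the binomial coefficient, ⟨1⟩_{j,λ} = 1·(1+λ)·(1+2λ)⋯(1+(j−1)λ) (with ⟨1⟩_{0,λ} = 1), the term {m+r \brace (p+1)+r}_{r,λ} is 0 when p+1 > m by convention, and for m = k the second summand vanishes since C(k−1,k) = 0. -/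

import Mathlib

open Finset

/-- Degenerate falling factorial `(x)_{n,λ} = x(x-λ)⋯(x-(n-1)λ)`. -/
noncomputable def dfall (lam x : ℝ) (n : ℕ) : ℝ := ∏ i ∈ Finset.range n, (x - i * lam)

/-- Ordinary falling factorial `(x)_n = x(x-1)⋯(x-n+1)`. -/
noncomputable def ffall (x : ℝ) (n : ℕ) : ℝ := ∏ i ∈ Finset.range n, (x - i)

/-- Degenerate rising factorial `⟨x⟩_{n,λ} = x(x+λ)⋯(x+(n-1)λ)`. -/
noncomputable def drise (lam x : ℝ) (n : ℕ) : ℝ := ∏ i ∈ Finset.range n, (x + i * lam)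

/-- Rising factorial `⟨x⟩_n = x(x+1)⋯(x+n-1)`. -/
noncomputable def rise (x : ℝ) (n : ℕ) : ℝ := ∏ i ∈ Finset.range n, (x + i)

/-- Degenerate falling factorial of an algebra element:
`(u)_{m,λ} = ∏_{i=0}^{m-1} (u - iλ·1)`, multiplied in increasing order of `i`. -/
noncomputable def algFall {A : Type*} [Ring A] [Algebra ℝ A] (lam : ℝ) (u : A) (m : ℕ) : A :=
  ((List.range m).map (fun i => u - ((i : ℝ) * lam) • (1 : A))).prod

lemma dfall_succ (lam x : ℝ) (n : ℕ) : dfall lam x (n + 1) = dfall lam x n * (x - n * lam) := by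
  simp [dfall, prod_range_succ]

lemma ffall_succ (x : ℝ) (n : ℕ) : ffall x (n + 1) = ffall x n * (x - n) := by
  simp [ffall, prod_range_succ]

lemma ffall_add_one_succ (x : ℝ) (n : ℕ) :
    ffall (x + 1) (n + 1) = ffall x (n + 1) + (n + 1) * ffall x n := by
  have h : ffall (x + 1) (n + 1) = (x + 1) * ffall x n := by
    unfold ffall
    rw [prod_range_succ', mul_comm]
    congr 1
    · simp
    · exact prod_congr rfl fun i _ => by push_cast; ring
  rw [h, ffall_succ]
  ring

lemma ffall_natCast_of_lt {n k : ℕ} (h : n < k) : ffall n k = 0 :=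
  prod_eq_zero (mem_range.2 h) (sub_self _)

lemma ffall_natCast_self_ne_zero (n : ℕ) : ffall n n ≠ 0 :=
  prod_ne_zero_iff.2 fun i hi => by
    rw [sub_ne_zero]
    exact_mod_cast (mem_range.1 hi).ne'

/-- The falling factorials are linearly independent as functions. -/
lemma eq_of_sum_mul_ffall_eq {N : ℕ} {a b : ℕ → ℝ}
    (h : ∀ x : ℝ, ∑ j ∈ range N, a j * ffall x j = ∑ j ∈ range N, b j * ffall x j)
    {j : ℕ} (hj : j < N) : a j = b j := by
  induction j using Nat.strong_induction_on with
  | _ j ih =>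
    have key := h j
    rw [← sub_eq_zero, ← sum_sub_distrib, sum_eq_single j] at key
    · rw [← sub_mul] at key
      exact sub_eq_zero.1 ((mul_eq_zero.1 key).resolve_right (ffall_natCast_self_ne_zero j))
    · intro i _ hij
      rcases lt_or_gt_of_ne hij with hlt | hgt
      · rw [ih i hlt (hlt.trans hj), sub_self]
      · simp [ffall_natCast_of_lt hgt]
    · simp [hj]

/-- The degenerate Chu–Vandermonde identity. -/
lemma dfall_add (lam x y : ℝ) (n : ℕ) :
    dfall lam (x + y) n
      = ∑ ij ∈ antidiagonal n, (n.choose ij.1 : ℝ) * (dfall lam x ij.1 * dfall lam y ij.2) := by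
  induction n with
  | zero => simp [dfall]
  | succ n ih =>
    rw [sum_antidiagonal_choose_succ_mul (fun i j => dfall lam x i * dfall lam y j),
      dfall_succ, ih, sum_mul, ← sum_add_distrib]
    refine sum_congr rfl fun ij hij => ?_
    have hn : (n : ℝ) = ij.1 + ij.2 := by exact_mod_cast (mem_antidiagonal.1 hij).symm
    have hc : n.choose ij.2 = n.choose ij.1 :=
      Nat.choose_symm_of_eq_add (by have := mem_antidiagonal.1 hij; omega)
    rw [dfall_succ, dfall_succ, hn, hc]
    ring

lemma neg_one_pow_mul_drise_one (lam : ℝ) (n : ℕ) :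
    (-1) ^ n * drise lam 1 n = dfall lam (-1) n := by
  induction n with
  | zero => simp [drise, dfall]
  | succ n ih =>
    have h : drise lam 1 (n + 1) = drise lam 1 n * (1 + n * lam) := by
      simp [drise, prod_range_succ]
    rw [dfall_succ, ← ih, h]
    ring

section StirlingArray

variable {lam : ℝ} {r : ℕ} {S : ℕ → ℤ → ℝ}

lemma dfall_eq_sum_range
    (hS : ∀ (n : ℕ) (x : ℝ), dfall lam (x + r) n = ∑ k ∈ range (n + 1), S n k * ffall x k)
    (hS0 : ∀ (n : ℕ) (k : ℤ), k < 0 ∨ (n : ℤ) < k → S n k = 0)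
    {n N : ℕ} (h : n < N) (x : ℝ) :
    dfall lam (x + r) n = ∑ k ∈ range N, S n k * ffall x k := by
  rw [hS]
  refine sum_subset (range_subset_range.2 h) fun j _ hj => ?_
  rw [hS0 n j (Or.inr (by simp at hj; omega)), zero_mul]

lemma stirling_succ_succ
    (hS : ∀ (n : ℕ) (x : ℝ), dfall lam (x + r) n = ∑ k ∈ range (n + 1), S n k * ffall x k)
    (hS0 : ∀ (n : ℕ) (k : ℤ), k < 0 ∨ (n : ℤ) < k → S n k = 0) (n k : ℕ) :
    S (n + 1) (k + 1) = S n k + (k + 1 + r - n * lam) * S n (k + 1) := by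
  have key := eq_of_sum_mul_ffall_eq (N := n + k + 3) (j := k + 1)
    (a := fun j => S (n + 1) j)
    (b := fun j => S n ((j : ℤ) - 1) + (j + r - n * lam) * S n j) ?_ (by omega)
  · simpa using key
  intro x
  rw [← dfall_eq_sum_range hS hS0 (by omega), dfall_succ,
    dfall_eq_sum_range hS hS0 (show n < n + k + 2 by omega)]
  simp only [add_mul (S n _), sum_add_distrib]
  rw [sum_range_succ' (fun j : ℕ => S n ((j : ℤ) - 1) * ffall x j),
    sum_range_succ (fun j : ℕ => (j + r - n * lam) * S n j * ffall x j),
    hS0 n ((0 : ℕ) - 1) (by simp), hS0 n (n + k + 2 : ℕ) (by push_cast; omega)]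
  simp only [zero_mul, mul_zero, add_zero, ← sum_add_distrib, sum_mul]
  refine sum_congr rfl fun j _ => ?_
  rw [ffall_succ]
  push_cast
  rw [add_sub_cancel_right]
  ring

lemma dfall_add_one_eq_sum_range
    (hS : ∀ (n : ℕ) (x : ℝ), dfall lam (x + r) n = ∑ k ∈ range (n + 1), S n k * ffall x k)
    (hS0 : ∀ (n : ℕ) (k : ℤ), k < 0 ∨ (n : ℤ) < k → S n k = 0)
    {n N : ℕ} (h : n < N) (x : ℝ) :
    dfall lam (x + 1 + r) n = ∑ j ∈ range N, (S n j + (j + 1) * S n (j + 1)) * ffall x j := by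
  rw [dfall_eq_sum_range hS hS0 (h.trans N.lt_succ_self), sum_range_succ']
  simp only [ffall_add_one_succ, mul_add, add_mul, sum_add_distrib]
  have h0 := sum_range_succ' (fun j : ℕ => S n j * ffall x j) N
  rw [sum_range_succ, hS0 n N (Or.inr (by exact_mod_cast h))] at h0
  have hz : ffall (x + 1) 0 = ffall x 0 := by simp [ffall]
  rw [hz, add_right_comm, ← h0, zero_mul, add_zero]
  simp only [← sum_add_distrib]
  refine sum_congr rfl fun j _ => ?_
  push_cast
  ring

/-- Lowering the shift parameter `r + 1` to `r`. -/
lemma stirling_eq_sum_antidiagonal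
    (hS : ∀ (n : ℕ) (x : ℝ), dfall lam (x + r) n = ∑ k ∈ range (n + 1), S n k * ffall x k)
    (hS0 : ∀ (n : ℕ) (k : ℤ), k < 0 ∨ (n : ℤ) < k → S n k = 0) {k p : ℕ} (hpk : p ≤ k) :
    S k p = ∑ m ∈ range (k + 1), (k.choose m : ℝ) * dfall lam (-1) (k - m)
      * (S m p + (p + 1) * S m (p + 1)) := by
  refine eq_of_sum_mul_ffall_eq (N := k + 1) (a := fun j => S k j)
    (b := fun j => ∑ m ∈ range (k + 1), (k.choose m : ℝ) * dfall lam (-1) (k - m)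
      * (S m j + (j + 1) * S m (j + 1))) (fun x => ?_) (by omega)
  simp only [sum_mul]
  rw [← hS, sum_comm, show x + r = x + 1 + r + -1 by ring, dfall_add,
    Nat.sum_antidiagonal_eq_sum_range_succ_mk]
  refine sum_congr rfl fun m hm => ?_
  rw [dfall_add_one_eq_sum_range hS hS0 (mem_range.1 hm), sum_mul, mul_sum]
  exact sum_congr rfl fun j _ => by ring

end StirlingArray

/-- the recurrence
`{k+r \brace p+r}_{r,λ} = Σ_{m=p}^{k} [ C(k,m)(−1)^{k−m}⟨1⟩_{k−m,λ}
   ({m+1+r \brace p+1+r}_{r,λ} − r{m+r \brace p+1+r}_{r,λ})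
 + λk C(k−1,m)(−1)^{k−m−1}⟨1⟩_{k−m−1,λ}{m+1+r \brace p+1+r}_{r,λ} ]` for `k ≥ p ≥ 0`. -/
theorem statement13 (lam : ℝ) (r : ℕ) (S : ℕ → ℤ → ℝ)
    (hS : ∀ (n : ℕ) (x : ℝ),
      dfall lam (x + r) n = ∑ k ∈ Finset.range (n + 1), S n k * ffall x k)
    (hS0 : ∀ (n : ℕ) (k : ℤ), k < 0 ∨ (n : ℤ) < k → S n k = 0)
    (k p : ℕ) (hpk : p ≤ k) :
    S k p
      = ∑ m ∈ Finset.Icc p k,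
          ((k.choose m : ℝ) * (-1 : ℝ) ^ (k - m) * drise lam 1 (k - m)
              * (S (m + 1) (p + 1) - r * S m (p + 1))
            + lam * k * ((k - 1).choose m : ℝ) * (-1 : ℝ) ^ (k - m - 1)
              * drise lam 1 (k - m - 1) * S (m + 1) (p + 1)) := by
  have hzero : ∀ m : ℕ, m < p → S (m + 1) (p + 1) = 0 ∧ S m (p + 1) = 0 := fun m hm =>
    ⟨hS0 _ _ (Or.inr (by push_cast; omega)), hS0 _ _ (Or.inr (by omega))⟩
  have hshift : ∑ m ∈ range (k + 1), lam * k * ((k - 1).choose m : ℝ) * (-1 : ℝ) ^ (k - m - 1)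
        * drise lam 1 (k - m - 1) * S (m + 1) (p + 1)
      = ∑ m ∈ range (k + 1), (k.choose m : ℝ) * dfall lam (-1) (k - m)
        * (lam * m * S m (p + 1)) := by
    rw [sum_range_succ, sum_range_succ' _ k]
    have hlast : (k : ℝ) * ((k - 1).choose k : ℝ) = 0 := by
      cases k <;> simp
    simp only [mul_assoc lam, hlast, Nat.cast_zero, mul_zero, zero_mul, add_zero]
    refine sum_congr rfl fun m hm => ?_
    obtain ⟨n, rfl⟩ : ∃ n, k = n + 1 := ⟨k - 1, by have := mem_range.1 hm; omega⟩
    have hc : ((n + 1 : ℕ) : ℝ) * (n.choose m : ℝ) = ((n + 1).choose (m + 1) : ℝ) * (m + 1) := by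
      exact_mod_cast Nat.add_one_mul_choose_eq n m
    rw [Nat.sub_sub, ← neg_one_pow_mul_drise_one, Nat.add_sub_cancel, hc]
    push_cast
    ring
  rw [stirling_eq_sum_antidiagonal hS hS0 hpk]
  rw [sum_subset (s₁ := Icc p k) (s₂ := range (k + 1)) (fun m hm => by simp at hm ⊢; omega) fun m hm hm' => by
    have := hzero m (by simp at hm hm'; omega)
    rw [this.1, this.2]
    ring]
  rw [sum_add_distrib, hshift, ← sum_add_distrib]
  refine sum_congr rfl fun m _ => ?_
  rw [stirling_succ_succ hS hS0, ← neg_one_pow_mul_drise_one]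
  ring
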